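/- For every integer h ≥ 2, the liminf as n → ∞ of F_h(n)/n^{1/h} is at least 1. -/

import Mathlib

/-- `A` is a classical Sidon set of order `h` (a `B_h`-set): any two multisets of `h`
elements of `A` with the same sum are equal. -/
def IsSidonSet (A : Set ℤ) (h : ℕ) : Prop :=
  ∀ s t : Multiset ℤ, Multiset.card s = h → Multiset.card t = h →
    (∀ a ∈ s, a ∈ A) → (∀ a ∈ t, a ∈ A) → s.sum = t.sum → s = t

/-- `Fh h n` is the largest cardinality of a classical Sidon set of order `h`
contained in `{1, …, n}`. -/
noncomputable def Fh (h n : ℕ) : ℕ :=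
  sSup {k | ∃ A : Finset ℤ, (A : Set ℤ) ⊆ Set.Icc 1 (n : ℤ) ∧ A.card = k ∧ IsSidonSet (↑A) h}

open MeasureTheory Filter Topology Real FourierTransform

noncomputable def phi0 (t : ℝ) : ℝ :=
  if |t| ≤ 2 then (2 - |t|) + sin (π * |t|) / π else 0

lemma phi0_cont : Continuous phi0 := by
  unfold phi0
  refine Continuous.if_le (by fun_prop) (by fun_prop) (by fun_prop) (by fun_prop) ?_
  intro t ht
  rw [ht, mul_comm, sin_two_pi]; simp

lemma phi0_supp : HasCompactSupport phi0 := by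
  refine HasCompactSupport.intro (isCompact_Icc (a := (-2:ℝ)) (b := 2)) ?_
  intro t ht
  unfold phi0
  rw [if_neg]
  intro h
  exact ht (abs_le.1 h)

noncomputable def K0 (v : ℝ) : ℝ := ∫ t, phi0 t * cos (t * v)

lemma phi0_int : Integrable phi0 := phi0_cont.integrable_of_hasCompactSupport phi0_supp

lemma phi0_neg (t : ℝ) : phi0 (-t) = phi0 t := by simp [phi0]

lemma K0_eq (v : ℝ) : (K0 v : ℂ) = ∫ t, (phi0 t : ℂ) * Complex.exp (-(t * v * Complex.I)) := by
  have h1 : ∀ t : ℝ, (phi0 t : ℂ) * Complex.exp (-(t * v * Complex.I))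
      = ((phi0 t * cos (t * v) : ℝ) : ℂ) - ((phi0 t * sin (t * v) : ℝ) : ℂ) * Complex.I := by
    intro t
    rw [show -((t:ℂ) * v * Complex.I) = (-((t * v : ℝ) : ℂ)) * Complex.I by push_cast; ring,
      Complex.exp_mul_I, Complex.cos_neg, Complex.sin_neg]
    push_cast
    ring
  have i1 : Integrable (fun t => phi0 t * cos (t * v)) :=
    (Continuous.mul phi0_cont (by fun_prop)).integrable_of_hasCompactSupport phi0_supp.mul_right
  have i2 : Integrable (fun t => phi0 t * sin (t * v)) :=
    (Continuous.mul phi0_cont (by fun_prop)).integrable_of_hasCompactSupport phi0_supp.mul_right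
  simp_rw [h1]
  rw [integral_sub i1.ofReal (i2.ofReal.mul_const _), integral_mul_const]
  rw [integral_complex_ofReal, integral_complex_ofReal]
  have : ∫ t, phi0 t * sin (t * v) = 0 := by
    have h := integral_neg_eq_self (fun t => phi0 t * sin (t * v)) volume
    simp only [phi0_neg, neg_mul, sin_neg, mul_neg, integral_neg] at h
    linarith
  rw [this]
  simp [K0]

lemma K0_closed (v : ℝ) (h0 : v ≠ 0) (h1 : v ^ 2 - π ^ 2 ≠ 0) :
    K0 v = 4 * (sin v) ^ 2 * π ^ 2 / (v ^ 2 * (π ^ 2 - v ^ 2)) := by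
  have e1 : K0 v = 2 * ∫ t in Set.Ioi 0, phi0 t * cos (t * v) := by
    unfold K0
    rw [← integral_comp_abs (f := fun t => phi0 t * cos (t * v))]
    congr 1
    ext t
    rcases abs_cases t with h | h <;> simp [h.1, phi0_neg]
  have e2 : ∫ t in Set.Ioi 0, phi0 t * cos (t * v)
      = ∫ t in (0:ℝ)..2, ((2 - t) + sin (π * t) / π) * cos (t * v) := by
    rw [intervalIntegral.integral_of_le (by norm_num)]
    rw [← Set.Ioc_union_Ioi_eq_Ioi (show (0:ℝ) ≤ 2 by norm_num),
      setIntegral_union (Set.Ioc_disjoint_Ioi le_rfl) measurableSet_Ioi]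
    · rw [setIntegral_eq_zero_of_forall_eq_zero (t := Set.Ioi 2), add_zero]
      · refine setIntegral_congr_fun measurableSet_Ioc ?_
        intro t ht
        simp only [phi0]
        rw [abs_of_pos ht.1, if_pos ht.2]
      · intro t ht
        have : (2:ℝ) < t := ht
        simp only [phi0]
        rw [if_neg, zero_mul]
        rw [abs_of_pos (by linarith)]; linarith
    · exact ((Continuous.mul phi0_cont (by fun_prop)).integrable_of_hasCompactSupport
        phi0_supp.mul_right).integrableOn
    · exact ((Continuous.mul phi0_cont (by fun_prop)).integrable_of_hasCompactSupport
        phi0_supp.mul_right).integrableOn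
  have hπ : π ≠ 0 := pi_ne_zero
  have e3 : ∫ t in (0:ℝ)..2, ((2 - t) + sin (π * t) / π) * cos (t * v)
      = ((2 - 2) * sin (2 * v) / v - cos (2 * v) / v ^ 2 +
          (π * cos (π * 2) * cos (2 * v) + v * sin (π * 2) * sin (2 * v)) / (v ^ 2 - π ^ 2) / π)
        - ((2 - 0) * sin (0 * v) / v - cos (0 * v) / v ^ 2 +
          (π * cos (π * 0) * cos (0 * v) + v * sin (π * 0) * sin (0 * v)) / (v ^ 2 - π ^ 2) / π) := by
    refine intervalIntegral.integral_eq_sub_of_hasDerivAt (f := fun t =>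
      ((2 - t) * sin (t * v) / v - cos (t * v) / v ^ 2 +
          (π * cos (π * t) * cos (t * v) + v * sin (π * t) * sin (t * v)) / (v ^ 2 - π ^ 2) / π)) ?_ ?_
    · intro t _
      have a1 : HasDerivAt (fun t : ℝ => sin (t * v)) (cos (t * v) * v) t := by
        simpa using ((hasDerivAt_id t).mul_const v).sin
      have a2 : HasDerivAt (fun t : ℝ => cos (t * v)) (-sin (t * v) * v) t := by
        simpa using ((hasDerivAt_id t).mul_const v).cos
      have a3 : HasDerivAt (fun t : ℝ => sin (π * t)) (cos (π * t) * π) t := by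
        simpa using ((hasDerivAt_id t).const_mul π).sin
      have a4 : HasDerivAt (fun t : ℝ => cos (π * t)) (-sin (π * t) * π) t := by
        simpa using ((hasDerivAt_id t).const_mul π).cos
      have a5 : HasDerivAt (fun t : ℝ => 2 - t) (-1) t := by
        simpa using (hasDerivAt_id t).const_sub 2
      have := ((((a5.mul a1).div_const v).sub (a2.div_const (v ^ 2))).add
        (((((a4.const_mul π).mul a2).add ((a3.const_mul v).mul a1)).div_const
          (v ^ 2 - π ^ 2)).div_const π))
      convert! this using 1
      field_simp
      ring
    · exact Continuous.intervalIntegrable (by fun_prop) _ _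
  rw [e1, e2, e3]
  have : π ^ 2 - v ^ 2 ≠ 0 := fun h => h1 (by linarith)
  rw [mul_comm π 2, sin_two_pi, cos_two_pi, cos_two_mul, cos_sq']
  simp only [zero_mul, mul_zero, sin_zero, cos_zero]
  rw [show v ^ 2 - π ^ 2 = - (π ^ 2 - v ^ 2) by ring]
  field_simp
  ring

lemma K0_nonpos (v : ℝ) (hv : π < |v|) : K0 v ≤ 0 := by
  have hp := pi_pos
  have h2 : π ^ 2 < v ^ 2 := by rw [← sq_abs v]; gcongr
  have h0 : v ≠ 0 := by rintro rfl; simp at hv; linarith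
  rw [K0_closed v h0 (by linarith)]
  apply div_nonpos_of_nonneg_of_nonpos (by positivity)
  exact mul_nonpos_of_nonneg_of_nonpos (by positivity) (by linarith)

lemma K0_fourier (w : ℝ) : 𝓕 (fun t => (phi0 t : ℂ)) w = (K0 (2 * π * w) : ℂ) := by
  rw [K0_eq, Real.fourier_eq']
  congr 1
  ext t
  simp only [smul_eq_mul]
  rw [mul_comm]
  congr 2
  simp
  ring

lemma K0_cont : Continuous K0 := by
  have : Continuous (𝓕 (fun t => (phi0 t : ℂ))) := by
    have := VectorFourier.fourierIntegral_continuous (V := ℝ) (W := ℝ) (μ := volume) (L := innerₗ ℝ) (e := Real.fourierChar)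
      Real.continuous_fourierChar (by exact continuous_inner) (f := fun t => (phi0 t : ℂ)) phi0_int.ofReal
    exact this
  have h2 : K0 = fun v => (𝓕 (fun t => (phi0 t : ℂ)) (v / (2 * π))).re := by
    ext v
    rw [K0_fourier, Complex.ofReal_re]
    congr 1
    field_simp
  rw [h2]
  fun_prop

lemma K0_int : Integrable K0 := by
  have hp := pi_pos
  have hO : ∀ v : ℝ, 2 * π ≤ |v| → |K0 v| ≤ 16 * π ^ 2 * (1 + v ^ 2)⁻¹ := by
    intro v hv
    have hv2 : (2 * π) ^ 2 ≤ v ^ 2 := by rw [← sq_abs v]; gcongr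
    have h3 := pi_gt_three
    have h0 : v ≠ 0 := by rintro rfl; simp at hv; linarith
    have hA : (1:ℝ) ≤ v ^ 2 - π ^ 2 := by nlinarith
    rw [K0_closed v h0 (by linarith), abs_div, ← div_eq_mul_inv, abs_mul (v ^ 2),
      abs_of_neg (show π ^ 2 - v ^ 2 < 0 by linarith), abs_of_nonneg (sq_nonneg v),
      abs_of_nonneg (by positivity), div_le_div_iff₀ (by apply mul_pos <;> [positivity; linarith]) (by positivity)]
    have hs : sin v ^ 2 ≤ 1 := sin_sq_le_one v
    have hs0 : 0 ≤ sin v ^ 2 := sq_nonneg _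
    calc 4 * sin v ^ 2 * π ^ 2 * (1 + v ^ 2) ≤ 4 * 1 * π ^ 2 * (v ^ 2 + v ^ 2) := by
          gcongr; nlinarith
      _ = 8 * π ^ 2 * (v ^ 2 * 1) := by ring
      _ ≤ 16 * π ^ 2 * (v ^ 2 * 1) := by gcongr; norm_num
      _ ≤ 16 * π ^ 2 * (v ^ 2 * -(π ^ 2 - v ^ 2)) := by gcongr; linarith
  obtain ⟨C, hC⟩ := (isCompact_Icc (a := -(2*π)) (b := 2*π)).exists_bound_of_continuousOn K0_cont.continuousOn
  have hb : Integrable (fun v : ℝ => (max C 0 * (1 + (2*π)^2) + 16 * π ^ 2) * (1 + v ^ 2)⁻¹) :=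
    integrable_inv_one_add_sq.const_mul _
  refine hb.mono' K0_cont.aestronglyMeasurable (ae_of_all _ fun v => ?_)
  rw [add_mul]
  rcases le_or_gt (2 * π) |v| with h | h
  · have := hO v h
    have : 0 ≤ max C 0 * (1 + (2*π)^2) * (1 + v ^ 2)⁻¹ := by positivity
    rw [Real.norm_eq_abs]; linarith
  · have h1 := hC v (abs_le.1 h.le)
    have h2 : v ^ 2 ≤ (2 * π) ^ 2 := by rw [← sq_abs v]; gcongr
    have : 0 ≤ 16 * π ^ 2 * (1 + v ^ 2)⁻¹ := by positivity
    have h4 : max C 0 ≤ max C 0 * (1 + (2*π)^2) * (1 + v ^ 2)⁻¹ := by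
      rw [← div_eq_mul_inv, le_div_iff₀ (by positivity)]
      gcongr
    linarith [le_max_left C 0]

lemma K0_pos : 0 < ∫ v, K0 v := by
  have hp := pi_pos
  have hF : 𝓕 (fun t => (phi0 t : ℂ)) = fun w => (K0 (2 * π * w) : ℂ) := funext K0_fourier
  have hi : Integrable (fun w => K0 (2 * π * w)) := K0_int.comp_mul_left' (by positivity)
  have h := congrFun (Continuous.fourierInv_fourier_eq (f := fun t => (phi0 t : ℂ))
    (Complex.continuous_ofReal.comp phi0_cont) phi0_int.ofReal (by rw [hF]; exact hi.ofReal)) 0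
  rw [hF, Real.fourierInv_eq'] at h
  simp only [inner_zero_right, mul_zero, Complex.ofReal_zero, zero_mul, Complex.exp_zero, one_smul] at h
  rw [integral_complex_ofReal, Complex.ofReal_inj, Measure.integral_comp_mul_left] at h
  simp only [phi0, smul_eq_mul] at h
  norm_num at h
  by_contra hn
  push Not at hn
  have : |π|⁻¹ * 2⁻¹ * ∫ v, K0 v ≤ 0 := mul_nonpos_of_nonneg_of_nonpos (by positivity) hn
  linarith

lemma exists_kernel (δ : ℝ) (hδ : 0 < δ) : ∃ φ K : ℝ → ℝ, Continuous φ ∧ HasCompactSupport φ ∧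
    (∀ v : ℝ, (K v : ℂ) = ∫ t, (φ t : ℂ) * Complex.exp (-(t * v * Complex.I))) ∧
    Continuous K ∧ Integrable K ∧ 0 < ∫ v, K v ∧ ∀ v, δ < |v| → K v ≤ 0 := by
  have hp := pi_pos
  set T : ℝ := π / δ with hT
  have hT0 : 0 < T := by positivity
  refine ⟨fun t => phi0 (T⁻¹ * t), fun v => T * K0 (T * v), by have := phi0_cont; fun_prop, ?_, ?_, ?_, ?_, ?_, ?_⟩
  · exact phi0_supp.comp_homeomorph (Homeomorph.mulLeft₀ T⁻¹ (by positivity))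
  · intro v
    have := Measure.integral_comp_mul_left (fun t : ℝ => (phi0 t : ℂ) * Complex.exp (-(t * (T * v : ℝ) * Complex.I))) T⁻¹
    rw [inv_inv, ← K0_eq, abs_of_pos hT0] at this
    push_cast
    rw [Complex.real_smul] at this
    rw [← this]
    congr 1
    ext t
    congr 3
    have : (T : ℂ) ≠ 0 := by exact_mod_cast hT0.ne'
    push_cast
    field_simp
  · have := K0_cont; fun_prop
  · exact (K0_int.comp_mul_left' hT0.ne').const_mul _
  · rw [integral_const_mul, Measure.integral_comp_mul_left]
    have := K0_pos
    rw [smul_eq_mul]; positivity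
  · intro v hv
    apply mul_nonpos_of_nonneg_of_nonpos hT0.le
    apply K0_nonpos
    rw [abs_mul, abs_of_pos hT0, hT, div_mul_eq_mul_div, lt_div_iff₀ hδ]
    gcongr

lemma exists_aux : ∃ f : ℂ → ℂ, ContinuousOn f {s | 1 ≤ s.re} ∧ ∀ s : ℂ, 1 < s.re →
    LSeries (fun n => (ArithmeticFunction.vonMangoldt n : ℂ)) s = 1 / (s - 1) + f s := by
  refine ⟨_, ArithmeticFunction.vonMangoldt.continuousOn_LFunctionResidueClassAux (1 : ZMod 1), ?_⟩
  intro s hs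
  have h := ArithmeticFunction.vonMangoldt.eqOn_LFunctionResidueClassAux (a := (1 : ZMod 1)) isUnit_one hs
  rw [h]
  have : (fun n : ℕ => ((ArithmeticFunction.vonMangoldt.residueClass (1 : ZMod 1) n : ℝ) : ℂ))
      = fun n => (ArithmeticFunction.vonMangoldt n : ℂ) := by
    ext n
    congr 1
    apply Set.indicator_of_mem
    exact Subsingleton.elim _ _
  simp [this]

section main
variable {φ K : ℝ → ℝ}

/-- the smoothed sum equals an integral of the L-series -/
lemma step1 (hφ : Continuous φ) (hs : HasCompactSupport φ)
    (hK : ∀ v : ℝ, (K v : ℂ) = ∫ t, (φ t : ℂ) * Complex.exp (-(t * v * Complex.I)))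
    (σ : ℝ) (hσ : 1 < σ) (y : ℝ) :
    HasSum (fun n : ℕ => ((ArithmeticFunction.vonMangoldt n * (n : ℝ) ^ (-σ) * K (log n - y) : ℝ) : ℂ))
      (∫ t : ℝ, LSeries (fun n => (ArithmeticFunction.vonMangoldt n : ℂ)) (σ + t * Complex.I) *
        (φ t * Complex.exp (t * y * Complex.I))) := by
  have hφi : Integrable φ := hφ.integrable_of_hasCompactSupport hs
  have hgc : Continuous (fun t : ℝ => (φ t : ℂ) * Complex.exp (t * y * Complex.I)) := by fun_prop
  have hterm : ∀ (n : ℕ) (t : ℝ), LSeries.term (fun n => (ArithmeticFunction.vonMangoldt n : ℂ)) (σ + t * Complex.I) n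
      * (φ t * Complex.exp (t * y * Complex.I)) =
      ((ArithmeticFunction.vonMangoldt n * (n : ℝ) ^ (-σ) : ℝ) : ℂ) *
        ((φ t : ℂ) * Complex.exp (-(t * (log n - y : ℝ) * Complex.I))) := by
    intro n t
    rcases Nat.eq_zero_or_pos n with rfl | hn
    · simp
    have hn' : (n : ℂ) ≠ 0 := by exact_mod_cast hn.ne'
    have hn0 : (0:ℝ) < n := by exact_mod_cast hn
    rw [LSeries.term_of_ne_zero hn.ne', div_eq_mul_inv, ← Complex.cpow_neg]
    have e1 : (n : ℂ) ^ (-((σ : ℂ) + t * Complex.I)) =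
        (((n : ℝ) ^ (-σ) : ℝ) : ℂ) * Complex.exp (-(t * (log n : ℝ) * Complex.I)) := by
      rw [neg_add, Complex.cpow_add _ _ hn', Complex.ofReal_cpow hn0.le]
      congr 1
      · push_cast; rfl
      · rw [Complex.cpow_def_of_ne_zero hn', ← Complex.ofReal_natCast n, ← Complex.ofReal_log hn0.le]
        congr 1; ring
    have e2 : Complex.exp (-(t * (log n - y : ℝ) * Complex.I)) =
        Complex.exp (-(t * (log n : ℝ) * Complex.I)) * Complex.exp (t * y * Complex.I) := by
      rw [← Complex.exp_add]; congr 1; push_cast; ring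
    rw [e1, e2]
    push_cast
    ring
  have key := hasSum_integral_of_summable_integral_norm (μ := volume)
    (F := fun (n : ℕ) (t : ℝ) => LSeries.term (fun n => (ArithmeticFunction.vonMangoldt n : ℂ)) (σ + t * Complex.I) n
      * (φ t * Complex.exp (t * y * Complex.I))) ?_ ?_
  · convert! key using 1
    · ext n
      simp_rw [hterm]
      rw [integral_const_mul, ← hK]
      push_cast; ring
    · congr 1
      ext t
      rw [tsum_mul_right]; rfl
  · intro n
    simp_rw [hterm]
    apply Integrable.const_mul
    refine Continuous.integrable_of_hasCompactSupport (by fun_prop) ?_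
    exact HasCompactSupport.mul_right (hs.comp_left (g := ((↑) : ℝ → ℂ)) (by simp))
  · have : ∀ n : ℕ, ∫ t : ℝ, ‖LSeries.term (fun n => (ArithmeticFunction.vonMangoldt n : ℂ)) (σ + t * Complex.I) n
      * (φ t * Complex.exp (t * y * Complex.I))‖ =
        (ArithmeticFunction.vonMangoldt n * (n : ℝ) ^ (-σ)) * ∫ t, |φ t| := by
      intro n
      rw [← integral_const_mul]
      congr 1
      ext t
      rw [hterm, norm_mul, norm_mul, Complex.norm_real, Complex.norm_real, Complex.norm_exp]
      have h0 : 0 ≤ ArithmeticFunction.vonMangoldt n * (n : ℝ) ^ (-σ) :=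
        mul_nonneg ArithmeticFunction.vonMangoldt_nonneg (by positivity)
      have e0 : (-((t : ℂ) * (log n - y : ℝ) * Complex.I)).re = 0 := by
        rw [← Complex.ofReal_mul, Complex.neg_re, Complex.re_ofReal_mul]; simp
      rw [Real.norm_of_nonneg h0, e0, exp_zero, mul_one, Real.norm_eq_abs]
    simp_rw [this]
    apply Summable.mul_right
    have hsum := (ArithmeticFunction.LSeriesSummable_vonMangoldt (s := (σ : ℂ)) (by simpa using hσ)).norm
    refine hsum.congr fun n => ?_
    rcases Nat.eq_zero_or_pos n with rfl | hn
    · simp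
    rw [LSeries.norm_term_eq, if_neg hn.ne', Complex.norm_real,
      Real.norm_of_nonneg ArithmeticFunction.vonMangoldt_nonneg, Complex.ofReal_re,
      Real.rpow_neg (by positivity), div_eq_mul_inv]

lemma step2 (hφ : Continuous φ) (hs : HasCompactSupport φ)
    (hK : ∀ v : ℝ, (K v : ℂ) = ∫ t, (φ t : ℂ) * Complex.exp (-(t * v * Complex.I)))
    (σ : ℝ) (hσ : 1 < σ) (y : ℝ) :
    (∫ t : ℝ, 1 / ((σ : ℂ) + t * Complex.I - 1) * (φ t * Complex.exp (t * y * Complex.I)))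
      = ((∫ w in Set.Ioi (0:ℝ), exp (-(σ - 1) * w) * K (w - y) : ℝ) : ℂ) := by
  have hφi : Integrable φ := hφ.integrable_of_hasCompactSupport hs
  have h1 : ∀ t : ℝ, 1 / ((σ : ℂ) + t * Complex.I - 1) * (φ t * Complex.exp (t * y * Complex.I)) =
      ∫ w in Set.Ioi (0:ℝ), Complex.exp (-(σ + t * Complex.I - 1) * w) * (φ t * Complex.exp (t * y * Complex.I)) := by
    intro t
    rw [integral_mul_const, integral_exp_mul_complex_Ioi (by simp; linarith)]
    congr 1
    simp
    rw [← neg_div_neg_eq]; simp [one_div]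
  simp_rw [h1]
  rw [integral_integral_swap]
  · rw [← integral_complex_ofReal]
    congr 1
    ext w
    push_cast
    rw [hK, ← integral_const_mul]
    congr 1
    ext t
    rw [mul_left_comm, mul_left_comm (Complex.exp _) (φ t : ℂ), ← Complex.exp_add, ← Complex.exp_add]
    congr 2
    push_cast
    ring
  · have hi : Integrable (fun p : ℝ × ℝ => |φ p.1| * exp (-(σ - 1) * p.2))
        (volume.prod (volume.restrict (Set.Ioi (0:ℝ)))) := by
      refine Integrable.mul_prod (f := fun t => |φ t|) (g := fun w => exp (-(σ - 1) * w)) hφi.abs ?_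
      exact integrableOn_exp_mul_Ioi (by linarith) 0
    refine hi.mono' (Continuous.aestronglyMeasurable (by unfold Function.uncurry; fun_prop)) (ae_of_all _ fun p => ?_)
    simp only [Function.uncurry]
    rw [norm_mul, norm_mul, Complex.norm_real, Complex.norm_exp, Complex.norm_exp]
    have e : ((p.1 : ℂ) * y * Complex.I).re = 0 := by simp
    have e2 : (-((σ:ℂ) + p.1 * Complex.I - 1) * p.2).re = -(σ - 1) * p.2 := by simp
    rw [e, e2, exp_zero, mul_one, mul_comm, Real.norm_eq_abs]

lemma step3 (g : ℝ → ℂ) :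
    Tendsto (fun y : ℝ => ∫ t : ℝ, g t * Complex.exp (t * y * Complex.I)) atTop (𝓝 0) := by
  have h := Real.tendsto_integral_exp_smul_cocompact g
  have h2 : Tendsto (fun y : ℝ => - y / (2 * π)) atTop (cocompact ℝ) := by
    refine Tendsto.mono_right ?_ atBot_le_cocompact
    apply Tendsto.atBot_div_const (by positivity)
    exact tendsto_neg_atTop_atBot
  refine (h.comp h2).congr fun y => ?_
  simp only [Function.comp]
  congr 1
  ext t
  rw [Circle.smul_def, Real.fourierChar_apply, smul_eq_mul, mul_comm]
  congr 2
  have : (π : ℂ) ≠ 0 := by exact_mod_cast pi_ne_zero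
  push_cast
  field_simp

lemma step4 (hφ : Continuous φ) (hs : HasCompactSupport φ) (f : ℂ → ℂ)
    (hf : ContinuousOn f {s | 1 ≤ s.re}) (y : ℝ) :
    Tendsto (fun σ : ℝ => ∫ t : ℝ, f (σ + t * Complex.I) * (φ t * Complex.exp (t * y * Complex.I)))
      (𝓝[>] 1) (𝓝 (∫ t : ℝ, f (1 + t * Complex.I) * (φ t * Complex.exp (t * y * Complex.I)))) := by
  obtain ⟨R, hR⟩ := hs.isCompact.isBounded.subset_closedBall 0
  have hR' : ∀ t, φ t ≠ 0 → t ∈ Set.Icc (-R) R := by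
    intro t ht
    have := hR (subset_tsupport _ ht)
    rw [Real.closedBall_eq_Icc] at this
    simpa using this
  have hcomp : ContinuousOn (fun p : ℝ × ℝ => f (p.1 + p.2 * Complex.I)) (Set.Ici 1 ×ˢ Set.univ) := by
    refine hf.comp (by fun_prop) ?_
    intro p hp
    simpa using hp.1
  obtain ⟨C, hC⟩ := ((isCompact_Icc (a := (1:ℝ)) (b := 2)).prod (isCompact_Icc (a := -R) (b := R))).exists_bound_of_continuousOn
    (hcomp.mono (Set.prod_mono (fun x hx => hx.1) (Set.subset_univ _)))
  have hcont : ∀ σ : ℝ, 1 ≤ σ → Continuous (fun t : ℝ => f (σ + t * Complex.I)) := by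
    intro σ hσ
    rw [← continuousOn_univ]
    exact hcomp.comp (f := fun t : ℝ => (σ, t)) (by fun_prop) (fun t _ => ⟨hσ, trivial⟩)
  have hev : ∀ᶠ σ : ℝ in 𝓝[>] 1, σ ∈ Set.Ioc 1 2 := Ioc_mem_nhdsGT (by norm_num)
  refine tendsto_integral_filter_of_dominated_convergence (fun t => C * |φ t|) ?_ ?_ ?_ ?_
  · filter_upwards [hev] with σ hσ
    have := hcont σ hσ.1.le
    exact (this.mul (by fun_prop)).aestronglyMeasurable
  · filter_upwards [hev] with σ hσ
    refine ae_of_all _ fun t => ?_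
    by_cases h0 : φ t = 0
    · simp [h0]
    have := hC (σ, t) ⟨⟨hσ.1.le, hσ.2⟩, hR' t h0⟩
    rw [norm_mul, norm_mul, Complex.norm_real, Complex.norm_exp]
    simp only [Real.norm_eq_abs]
    have e : ((t : ℂ) * y * Complex.I).re = 0 := by simp
    rw [e, exp_zero, mul_one]
    gcongr
  · exact ((hφ.integrable_of_hasCompactSupport hs).abs).const_mul _
  · refine ae_of_all _ fun t => ?_
    refine Tendsto.mul_const _ ?_
    have h1 : ContinuousWithinAt (fun σ : ℝ => f (σ + t * Complex.I)) (Set.Ici 1) 1 :=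
      (hcomp.comp (f := fun σ : ℝ => (σ, t)) (by fun_prop) (fun σ hσ => ⟨hσ, trivial⟩)) 1 (by simp)
    have := h1.tendsto.mono_left (nhdsWithin_mono _ Set.Ioi_subset_Ici_self)
    simpa using this

lemma step5 (hKc : Continuous K) (hKi : Integrable K) (y : ℝ) :
    Tendsto (fun σ : ℝ => ∫ w in Set.Ioi (0:ℝ), exp (-(σ - 1) * w) * K (w - y))
      (𝓝[>] 1) (𝓝 (∫ w in Set.Ioi (0:ℝ), K (w - y))) := by
  refine tendsto_integral_filter_of_dominated_convergence (fun w => |K (w - y)|) ?_ ?_ ?_ ?_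
  · exact Eventually.of_forall fun σ => Continuous.aestronglyMeasurable (by fun_prop)
  · filter_upwards [self_mem_nhdsWithin] with σ hσ
    refine (ae_restrict_iff' measurableSet_Ioi).2 (ae_of_all _ fun w hw => ?_)
    have h1 : (1:ℝ) < σ := hσ
    have h2 : (0:ℝ) < w := hw
    rw [norm_mul, Real.norm_of_nonneg (exp_pos _).le, Real.norm_eq_abs]
    have : exp (-(σ - 1) * w) ≤ 1 := exp_le_one_iff.2 (by nlinarith)
    exact mul_le_of_le_one_left (abs_nonneg _) this
  · exact (hKi.comp_sub_right y).abs.integrableOn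
  · refine ae_of_all _ fun w => ?_
    have : Continuous (fun σ : ℝ => exp (-(σ - 1) * w) * K (w - y)) := by fun_prop
    have := (this.tendsto 1).mono_left (nhdsWithin_le_nhds (s := Set.Ioi 1))
    simpa using this

lemma step6 (hKi : Integrable K) :
    Tendsto (fun y : ℝ => ∫ w in Set.Ioi (0:ℝ), K (w - y)) atTop (𝓝 (∫ w, K w)) := by
  have e : ∀ y : ℝ, ∫ w in Set.Ioi (0:ℝ), K (w - y) = ∫ w, (Set.Ioi (-y)).indicator K w := by
    intro y
    rw [← integral_indicator measurableSet_Ioi, ← integral_sub_right_eq_self ((Set.Ioi (-y)).indicator K) y]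
    congr 1
    ext w
    simp only [Set.indicator, Set.mem_Ioi]
    congr 1
    simp
  simp_rw [e]
  refine tendsto_integral_filter_of_dominated_convergence (fun w => |K w|) ?_ ?_ hKi.abs ?_
  · exact Eventually.of_forall fun y => hKi.aestronglyMeasurable.indicator measurableSet_Ioi
  · exact Eventually.of_forall fun y => ae_of_all _ fun w => norm_indicator_le_norm_self _ _
  · refine ae_of_all _ fun w => ?_
    refine tendsto_const_nhds.congr' ?_
    filter_upwards [eventually_gt_atTop (-w)] with y hy
    rw [Set.indicator_of_mem]
    simp; linarith

end main

lemma exists_vonMangoldt (δ : ℝ) (hδ : 0 < δ) :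
    ∀ᶠ y : ℝ in atTop, ∃ n : ℕ, ArithmeticFunction.vonMangoldt n ≠ 0 ∧ |log n - y| ≤ δ := by
  obtain ⟨φ, K, hφ, hs, hK, hKc, hKi, hpos, hneg⟩ := exists_kernel δ hδ
  obtain ⟨f, hf, hL⟩ := exists_aux
  have t1 := step6 hKi
  have t2 := step3 (fun t => f (1 + t * Complex.I) * φ t)
  have t3 := t1.add ((Complex.continuous_re.tendsto _).comp t2)
  have := t3.eventually_const_lt (u := 0) (by simpa using hpos)
  filter_upwards [this] with y hy
  by_contra! hcon
  have t4 := (step5 hKc hKi y).add ((Complex.continuous_re.tendsto _).comp (step4 hφ hs f hf y))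
  have hle := le_of_tendsto t4 (b := 0) ?_
  · simp only [Function.comp, mul_assoc] at hy hle
    linarith
  · filter_upwards [self_mem_nhdsWithin] with σ hσ
    have hσ1 : (1:ℝ) < σ := hσ
    have a1 := step1 hφ hs hK σ hσ1 y
    have a2 := step2 hφ hs hK σ hσ1 y
    have hfc : Continuous (fun t : ℝ => f (σ + t * Complex.I)) := by
      rw [← continuousOn_univ]
      refine hf.comp (by fun_prop) ?_
      intro t _
      simpa using hσ1.le
    have hcs : ∀ g : ℝ → ℂ, Continuous g →
        Integrable (fun t : ℝ => g t * (φ t * Complex.exp (t * y * Complex.I))) := by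
      intro g hg
      refine Continuous.integrable_of_hasCompactSupport (hg.mul (by fun_prop)) ?_
      exact HasCompactSupport.mul_left (HasCompactSupport.mul_right (hs.comp_left (g := ((↑) : ℝ → ℂ)) (by simp)))
    have hne : ∀ t : ℝ, (σ : ℂ) + t * Complex.I - 1 ≠ 0 := by
      intro t h
      have := congrArg Complex.re h
      simp at this
      linarith
    have hsplit : (∫ t : ℝ, LSeries (fun n => (ArithmeticFunction.vonMangoldt n : ℂ)) (σ + t * Complex.I) *
        (φ t * Complex.exp (t * y * Complex.I))) =
        (∫ t : ℝ, 1 / ((σ : ℂ) + t * Complex.I - 1) * (φ t * Complex.exp (t * y * Complex.I))) +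
        ∫ t : ℝ, f (σ + t * Complex.I) * (φ t * Complex.exp (t * y * Complex.I)) := by
      rw [← integral_add (hcs _ (by fun_prop (disch := exact hne _))) (hcs _ hfc)]
      congr 1
      ext t
      rw [hL _ (by simpa using hσ1)]
      ring
    rw [hsplit, a2] at a1
    have a3 := Complex.hasSum_re a1
    simp only [Complex.ofReal_re, Complex.add_re] at a3
    refine hasSum_le (fun n => ?_) a3 hasSum_zero
    by_cases hn : ArithmeticFunction.vonMangoldt n = 0
    · simp [hn]
    · exact mul_nonpos_of_nonneg_of_nonpos (mul_nonneg ArithmeticFunction.vonMangoldt_nonneg (by positivity))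
        (hneg _ (hcon n hn))

/-- Bose-Chowla -/
lemma bose_chowla_field {F E : Type*} [Field F] [Field E] [Algebra F E] [Fintype F] [Finite E]
    (h : ℕ) (hh : 2 ≤ h) (hr : Module.finrank F E = h) :
    ∃ A : Finset ℤ, (A : Set ℤ) ⊆ Set.Icc 1 ((Fintype.card F ^ h : ℕ) : ℤ) ∧
      A.card = Fintype.card F ∧ IsSidonSet (↑A) h := by
  classical
  have : Fintype E := Fintype.ofFinite E
  obtain ⟨θ, hθ⟩ := Field.exists_primitive_element_of_finite_top F E
  have hdeg : (minpoly F θ).natDegree = h := by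
    rw [← hr]; exact (Field.primitive_element_iff_minpoly_natDegree_eq F θ).1 hθ
  have hroot : ∀ P : Polynomial F, P.natDegree < h → Polynomial.aeval θ P = 0 → P = 0 := by
    intro P hP h0
    by_contra hne
    have := Polynomial.natDegree_le_natDegree (minpoly.degree_le_of_ne_zero F θ hne h0)
    omega
  have hne : ∀ a : F, θ - algebraMap F E a ≠ 0 := by
    intro a h0
    have := hroot (Polynomial.X - Polynomial.C a) (by simp; omega) (by simpa using h0)
    exact Polynomial.X_sub_C_ne_zero a this
  obtain ⟨g, hg⟩ := IsCyclic.exists_generator (α := Eˣ)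
  have hord : orderOf g = Fintype.card Eˣ := orderOf_eq_card_of_forall_mem_zpowers hg ▸ Nat.card_eq_fintype_card
  have hcard : Fintype.card Eˣ ≤ Fintype.card F ^ h := by
    rw [Fintype.card_units, ← hr, ← Module.card_eq_pow_finrank (K := F) (V := E)]
    omega
  have hlog : ∀ a : F, ∃ d : ℕ, 1 ≤ d ∧ d ≤ Fintype.card F ^ h ∧ (g : E) ^ d = θ - algebraMap F E a := by
    intro a
    have hm := hg (Units.mk0 _ (hne a))
    rw [← mem_powers_iff_mem_zpowers, mem_powers_iff_mem_range_orderOf] at hm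
    obtain ⟨k, hk, hk2⟩ := Finset.mem_image.1 hm
    rw [Finset.mem_range] at hk
    have hk3 : (g : E) ^ k = θ - algebraMap F E a := by
      rw [← Units.val_pow_eq_pow_val, hk2]; rfl
    rcases Nat.eq_zero_or_pos k with rfl | hpos
    · refine ⟨orderOf g, orderOf_pos g, by omega, ?_⟩
      rw [← hk3, ← Units.val_pow_eq_pow_val, pow_orderOf_eq_one]; simp
    · exact ⟨k, hpos, by omega, hk3⟩
  choose d hd1 hd2 hd3 using hlog
  let D : F → ℤ := fun a => (d a : ℤ)
  have hinj : Function.Injective D := by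
    intro a b hab
    have hab' : d a = d b := Int.ofNat.inj hab
    have := hd3 a
    rw [hab', hd3 b] at this
    have := sub_right_injective this
    exact (algebraMap F E).injective this.symm
  refine ⟨Finset.univ.image D, ?_, ?_, ?_⟩
  · intro z hz
    obtain ⟨a, -, rfl⟩ := Finset.mem_image.1 (Finset.mem_coe.1 hz)
    exact ⟨Int.ofNat_le.2 (hd1 a), Int.ofNat_le.2 (hd2 a)⟩
  · rw [Finset.card_image_of_injective _ hinj, Finset.card_univ]
  · intro s t hs ht hsA htA hsum
    have lift : ∀ s : Multiset ℤ, (∀ a ∈ s, a ∈ ((Finset.univ.image D : Finset ℤ) : Set ℤ)) →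
        ∃ s' : Multiset F, s'.map D = s := by
      intro s hs
      refine ⟨s.map (Function.invFun D), ?_⟩
      rw [Multiset.map_map]
      conv_rhs => rw [← Multiset.map_id s]
      refine Multiset.map_congr rfl fun z hz => ?_
      obtain ⟨a, -, rfl⟩ := Finset.mem_image.1 (Finset.mem_coe.1 (hs z hz))
      simp [Function.leftInverse_invFun hinj a]
    obtain ⟨s', rfl⟩ := lift s hsA
    obtain ⟨t', rfl⟩ := lift t htA
    have hsum' : (s'.map d).sum = (t'.map d).sum := by
      have e : ∀ u : Multiset F, (u.map D).sum = (((u.map d).sum : ℕ) : ℤ) := by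
        intro u
        rw [Nat.cast_multiset_sum, Multiset.map_map]; rfl
      rw [e, e] at hsum
      exact_mod_cast hsum
    let P : Multiset F → Polynomial F := fun u => (u.map (fun a => Polynomial.X - Polynomial.C a)).prod
    have hev : ∀ u : Multiset F, Polynomial.aeval θ (P u) = (g : E) ^ (u.map d).sum := by
      intro u
      induction u using Multiset.induction_on with
      | empty => simp [P]
      | cons a u ih =>
        simp only [P, Multiset.map_cons, Multiset.prod_cons, Multiset.sum_cons, map_mul, pow_add] at ih ⊢
        rw [ih, hd3]; simp
    have hmon : ∀ u, (P u).Monic := fun u => Polynomial.monic_multisetProd_X_sub_C u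
    have hnd : ∀ u, (P u).natDegree = Multiset.card u := fun u =>
      Polynomial.natDegree_multiset_prod_X_sub_C_eq_card u
    rw [Multiset.card_map] at hs ht
    have hPeq : P s' = P t' := by
      rw [← sub_eq_zero]
      by_contra hne0
      have hlt : (P s' - P t').natDegree < h := by
        have hd : ∀ u, (P u).degree = (Multiset.card u : ℕ) := fun u => by
          rw [Polynomial.degree_eq_natDegree (hmon u).ne_zero, hnd]
        have := Polynomial.degree_sub_lt_left (p := P s') (q := P t') (by rw [hd, hd, hs, ht])
          (hmon _).ne_zero (by rw [(hmon _).leadingCoeff, (hmon _).leadingCoeff])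
        rw [hd, hs] at this
        exact (Polynomial.natDegree_lt_iff_degree_lt hne0).2 this
      exact hne0 (hroot _ hlt (by rw [map_sub, hev, hev, hsum', sub_self]))
    have := congrArg Polynomial.roots hPeq
    simp only [P, Polynomial.roots_multiset_prod_X_sub_C] at this
    rw [this]

lemma bose_chowla (q h : ℕ) (hh : 2 ≤ h) (hq : IsPrimePow q) :
    ∃ A : Finset ℤ, (A : Set ℤ) ⊆ Set.Icc 1 ((q ^ h : ℕ) : ℤ) ∧
      A.card = q ∧ IsSidonSet (↑A) h := by
  obtain ⟨p, k, hp, hk, rfl⟩ := hq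
  have : Fact p.Prime := ⟨hp.nat_prime⟩
  have : NeZero h := ⟨by omega⟩
  have : Fintype (GaloisField p k) := Fintype.ofFinite _
  have hc : Fintype.card (GaloisField p k) = p ^ k := by
    rw [← Nat.card_eq_fintype_card]; exact GaloisField.card p k hk.ne'
  have := bose_chowla_field (F := GaloisField p k) (E := FiniteField.Extension (GaloisField p k) p h) h hh
    (FiniteField.finrank_extension _ _ _)
  rwa [hc] at this

lemma Fh_set_bdd (h n : ℕ) : BddAbove {k | ∃ A : Finset ℤ, (A : Set ℤ) ⊆ Set.Icc 1 (n : ℤ) ∧ A.card = k ∧ IsSidonSet (↑A) h} := by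
  refine ⟨n, ?_⟩
  rintro k ⟨A, hA, rfl, -⟩
  have : A ⊆ Finset.Icc 1 (n : ℤ) := by
    intro z hz
    exact Finset.mem_Icc.2 (hA hz)
  simpa using Finset.card_le_card this

lemma le_Fh (h n q : ℕ) (hh : 2 ≤ h) (hq : IsPrimePow q) (hn : q ^ h ≤ n) : q ≤ Fh h n := by
  obtain ⟨A, h1, h2, h3⟩ := bose_chowla q h hh hq
  refine le_csSup (Fh_set_bdd h n) ⟨A, h1.trans ?_, h2, h3⟩
  exact Set.Icc_subset_Icc le_rfl (by exact_mod_cast hn)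

lemma Fh_pow_le (h n : ℕ) (hh : 2 ≤ h) (hn : 1 ≤ n) : (Fh h n) ^ h ≤ h.factorial * (h * n) := by
  classical
  have hmem : Fh h n ∈ {k | ∃ A : Finset ℤ, (A : Set ℤ) ⊆ Set.Icc 1 (n : ℤ) ∧ A.card = k ∧ IsSidonSet (↑A) h} := by
    refine Nat.sSup_mem ⟨0, ∅, by simp, by simp, ?_⟩ (Fh_set_bdd h n)
    intro s t hs ht hsA
    have : s = 0 := Multiset.eq_zero_of_forall_notMem fun a ha => by simpa using hsA a ha
    subst this
    simp at hs; omega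
  obtain ⟨A, hA, hc, hS⟩ := hmem
  rw [← hc]
  have hsub : (Finset.univ : Finset (Sym A h)).card ≤ (Finset.Icc (1:ℤ) (h * n)).card := by
    have hcm : ∀ s : Sym A h, Multiset.card ((s : Multiset A).map Subtype.val) = h := by
      intro s; rw [Multiset.card_map]; exact s.2
    have hs' : ∀ s : Sym A h, ∀ a ∈ (s : Multiset A).map Subtype.val, a ∈ A := by
      intro s a ha
      obtain ⟨b, -, rfl⟩ := Multiset.mem_map.1 ha
      exact b.2
    refine Finset.card_le_card_of_injOn (fun s => ((s : Multiset A).map Subtype.val).sum) ?_ ?_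
    · intro s _
      have u := Multiset.sum_le_card_nsmul ((s : Multiset A).map Subtype.val) (n : ℤ)
        (fun a ha => (hA (hs' s a ha)).2)
      have l := Multiset.card_nsmul_le_sum (s := (s : Multiset A).map Subtype.val) (a := (1:ℤ))
        (fun a ha => (hA (hs' s a ha)).1)
      rw [hcm] at u l
      simp only [nsmul_eq_mul, mul_one] at u l
      refine Finset.mem_coe.2 (Finset.mem_Icc.2 ⟨?_, u⟩)
      have : (2:ℤ) ≤ h := by exact_mod_cast hh
      linarith
    · intro s _ t _ hst
      apply Sym.coe_injective
      exact Multiset.map_injective Subtype.val_injective (hS _ _ (hcm s) (hcm t) (hs' s) (hs' t) hst)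
  rw [Finset.card_univ, Sym.card_sym_eq_choose, Fintype.card_coe] at hsub
  have hsub2 : (A.card + h - 1).choose h ≤ h * n := by
    refine hsub.trans ?_
    rw [Int.card_Icc]
    have : ((h * n : ℕ) : ℤ) = (h:ℤ) * n := by push_cast; ring
    omega
  calc A.card ^ h ≤ A.card.ascFactorial h := Nat.pow_succ_le_ascFactorial _ _
    _ = h.factorial * (A.card + h - 1).choose h := Nat.ascFactorial_eq_factorial_mul_choose' _ _
    _ ≤ _ := Nat.mul_le_mul_left _ hsub2

lemma ratio_ge (h : ℕ) (hh : 2 ≤ h) (c : ℝ) (hc0 : 0 < c) (hc1 : c < 1) :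
    ∀ᶠ n : ℕ in atTop, c ≤ (Fh h n : ℝ) / (n : ℝ) ^ ((1 : ℝ) / h) := by
  have hh0 : (0:ℝ) < h := by positivity
  have hlc : log c < 0 := log_neg hc0 hc1
  have hev := exists_vonMangoldt (-log c / 2) (by linarith)
  have hy : Tendsto (fun n : ℕ => log n / h + log c / 2) atTop atTop := by
    refine tendsto_atTop_add_const_right _ _ ?_
    exact (tendsto_log_atTop.comp tendsto_natCast_atTop_atTop).atTop_div_const hh0
  filter_upwards [hy.eventually hev, eventually_ge_atTop 1] with n hn hn1
  obtain ⟨q, hq, hab⟩ := hn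
  have hqpp : IsPrimePow q := ArithmeticFunction.vonMangoldt_ne_zero_iff.1 hq
  have hq0 : (0:ℝ) < q := by exact_mod_cast hqpp.pos
  have hn0 : (0:ℝ) < n := by exact_mod_cast hn1
  rw [abs_le] at hab
  have h1 : log q ≤ log n / h := by linarith [hab.2]
  have h2 : log c + log n / h ≤ log q := by linarith [hab.1]
  have hpow : q ^ h ≤ n := by
    have : (q:ℝ) ^ h ≤ n := by
      rw [← log_le_log_iff (by positivity) hn0, log_pow, mul_comm]
      exact (le_div_iff₀ hh0).1 h1
    exact_mod_cast this
  have hF : (q:ℝ) ≤ Fh h n := by exact_mod_cast le_Fh h n q hh hqpp hpow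
  rw [le_div_iff₀ (by positivity)]
  refine le_trans ?_ hF
  rw [← log_le_log_iff (by positivity) hq0, log_mul hc0.ne' (by positivity), log_rpow hn0]
  convert h2 using 2
  ring

theorem stmt_2 (h : ℕ) (hh : 2 ≤ h) :
    1 ≤ Filter.liminf (fun n : ℕ => (Fh h n : ℝ) / (n : ℝ) ^ ((1 : ℝ) / h)) Filter.atTop := by
  have hcob : IsCoboundedUnder (· ≥ ·) atTop (fun n : ℕ => (Fh h n : ℝ) / (n : ℝ) ^ ((1 : ℝ) / h)) := by
    refine IsCoboundedUnder.of_frequently_le (a := (((h.factorial * h : ℕ) : ℝ)) ^ ((1:ℝ)/h)) ?_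
    refine Eventually.frequently ?_
    filter_upwards [eventually_ge_atTop 1] with n hn
    have hn0 : (0:ℝ) < n := by exact_mod_cast hn
    rw [div_le_iff₀ (by positivity), ← mul_rpow (by positivity) hn0.le]
    have h1 : ((Fh h n : ℝ)) ^ h ≤ ((h.factorial * h : ℕ) : ℝ) * n := by
      have := Fh_pow_le h n hh hn
      rw [← mul_assoc] at this
      exact_mod_cast this
    calc (Fh h n : ℝ) = ((Fh h n : ℝ) ^ h) ^ ((1:ℝ)/h) := by
          rw [one_div, pow_rpow_inv_natCast (by positivity) (by omega)]
      _ ≤ _ := by gcongr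
  refine le_of_forall_lt fun c hc => ?_
  obtain ⟨c', h1, h2⟩ := exists_between (max_lt hc zero_lt_one)
  refine lt_of_lt_of_le (lt_of_le_of_lt (le_max_left _ _) h1) ?_
  exact le_liminf_of_le hcob (ratio_ge h hh c' (lt_of_le_of_lt (le_max_right _ _) h1) h2)
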